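/- arXiv:1501.04312 — 5 statements merged into one kernel-verified Lean document; each statement's English description precedes it below -/
import Mathlib

section
/- For every integer K ≥ 2, the point x̂_K = 1 − (1/K)^{1/(K−1)} lies in (0,1), satisfies the stationarity condition K(1 − x̂_K)^{K−1} = 1, and is the unique minimizer of D_K on [0,1]; that is, D_K(x̂_K) ≤ D_K(x) for all x ∈ [0,1], with equality only when x = x̂_K. -/
/-- The graph of `t ↦ t ^ n` on `[0, ∞)` lies strictly above its tangent at `a > 0`, except at
the point of contact. -/
lemma pow_add_tangent_lt_pow {n : ℕ} (hn : 2 ≤ n) {a y : ℝ} (ha : 0 < a) (hy : 0 ≤ y)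
    (hya : y ≠ a) : a ^ n + n * a ^ (n - 1) * (y - a) < y ^ n := by
  have hs : -1 ≤ y / a - 1 := by linarith [div_nonneg hy ha.le]
  have hs' : y / a - 1 ≠ 0 := by
    rw [sub_ne_zero, Ne, div_eq_one_iff_eq ha.ne']
    exact hya
  have hn' : (1 : ℝ) < n := by exact_mod_cast hn
  have bernoulli := one_add_mul_self_lt_rpow_one_add hs hs' hn'
  rw [Real.rpow_natCast, add_sub_cancel, div_pow, lt_div_iff₀ (pow_pos ha n)] at bernoulli
  obtain ⟨m, rfl⟩ : ∃ m, n = m + 1 := ⟨n - 1, by omega⟩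
  refine lt_of_eq_of_lt ?_ bernoulli
  rw [Nat.add_sub_cancel, pow_succ]
  field_simp

/-- For every integer `K ≥ 2`, the point `xhat_K = 1 − (1/K)^(1/(K−1))` lies in `(0,1)`,
satisfies the stationarity condition `K·(1 − xhat_K)^(K−1) = 1`, and is the unique minimizer
of `D_K(x) = (1 − (1−x)^K)·(x/2) + (1−x)^K·((1+x)/2)` on `[0,1]`. -/
theorem oia_one_bit_optimal_threshold (K : ℕ) (hK : 2 ≤ K)
    (D : ℝ → ℝ)
    (hD : D = fun x : ℝ => (1 - (1 - x) ^ K) * (x / 2) + (1 - x) ^ K * ((1 + x) / 2))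
    (xhat : ℝ) (hxhat : xhat = 1 - (1 / (K : ℝ)) ^ ((1 : ℝ) / ((K : ℝ) - 1))) :
    xhat ∈ Set.Ioo (0:ℝ) 1 ∧
    (K : ℝ) * (1 - xhat) ^ (K - 1) = 1 ∧
    ∀ x ∈ Set.Icc (0:ℝ) 1, D xhat ≤ D x ∧ (D x = D xhat → x = xhat) := by
  have hK1 : (1 : ℝ) < K := by exact_mod_cast hK
  have hK0 : (0 : ℝ) < K := by linarith
  have hinv : (0 : ℝ) < 1 / K := by positivity
  have hexp : (0 : ℝ) < 1 / ((K : ℝ) - 1) := one_div_pos.mpr (by linarith)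
  obtain ⟨a, ha⟩ : ∃ a : ℝ, a = (1 / (K : ℝ)) ^ ((1 : ℝ) / ((K : ℝ) - 1)) := ⟨_, rfl⟩
  rw [← ha] at hxhat
  have ha0 : 0 < a := ha ▸ Real.rpow_pos_of_pos hinv _
  have ha1 : a < 1 :=
    ha ▸ Real.rpow_lt_one hinv.le ((div_lt_one hK0).mpr hK1) hexp
  have hstat : (K : ℝ) * a ^ (K - 1) = 1 := by
    have hcast : ((K - 1 : ℕ) : ℝ) = (K : ℝ) - 1 := by
      rw [Nat.cast_sub (by omega), Nat.cast_one]
    rw [ha, ← Real.rpow_natCast, ← Real.rpow_mul hinv.le, hcast,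
      one_div_mul_cancel (by linarith), Real.rpow_one, mul_one_div_cancel hK0.ne']
  have hxa : 1 - xhat = a := by linarith
  have hlt : ∀ x ∈ Set.Icc (0 : ℝ) 1, x ≠ xhat → D xhat < D x := by
    intro x hx hne
    have htan := pow_add_tangent_lt_pow hK ha0 (sub_nonneg.mpr hx.2)
      (fun h => hne (by linarith))
    rw [hstat] at htan
    simp only [hD, hxa]
    linarith
  refine ⟨⟨by linarith, by linarith⟩, by rw [hxa, hstat], fun x hx => ⟨?_, fun h => ?_⟩⟩
  · rcases eq_or_ne x xhat with rfl | hne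
    · exact le_rfl
    · exact (hlt x hx hne).le
  · by_contra hne
    exact (hlt x hx hne).ne' h
end

section
/- For every integer K ≥ 2, the minimum value of D_K on [0,1] is D_K(x̂_K) = (1/2)(1/K)^{K/(K−1)} − (1/2)(1/K)^{1/(K−1)} + 1/2, where x̂_K = 1 − (1/K)^{1/(K−1)}. -/
/-- The graph of `t ↦ t ^ n` on `[0, ∞)` lies above its tangent line of slope one, where the point
of tangency `t₀` satisfies `n * t₀ ^ n = t₀`. -/
lemma pow_sub_self_le_of_mul_pow_eq {n : ℕ} {t₀ t : ℝ} (h₀ : 0 < t₀) (ht : 0 ≤ t)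
    (h : n * t₀ ^ n = t₀) : t₀ ^ n - t₀ ≤ t ^ n - t := by
  have hb := one_add_mul_le_pow (a := t / t₀ - 1) (by linarith [div_nonneg ht h₀.le]) n
  have hm := mul_le_mul_of_nonneg_left hb (pow_pos h₀ n).le
  rw [add_sub_cancel, ← mul_pow, mul_div_cancel₀ _ h₀.ne'] at hm
  have e : t₀ ^ n * (1 + n * (t / t₀ - 1)) = t₀ ^ n + (n * t₀ ^ n) * (t / t₀ - 1) := by ring
  rw [e, h, mul_sub, mul_div_cancel₀ _ h₀.ne'] at hm
  linarith

/-- For every integer `K ≥ 2`, the minimum value of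
`D_K(x) = (1 − (1−x)^K)·(x/2) + (1−x)^K·((1+x)/2)` on `[0,1]` is
`D_K(xhat_K) = (1/2)(1/K)^(K/(K−1)) − (1/2)(1/K)^(1/(K−1)) + 1/2`,
where `xhat_K = 1 − (1/K)^(1/(K−1))`. -/
theorem oia_one_bit_min_metric_value (K : ℕ) (hK : 2 ≤ K)
    (D : ℝ → ℝ)
    (hD : D = fun x : ℝ => (1 - (1 - x) ^ K) * (x / 2) + (1 - x) ^ K * ((1 + x) / 2))
    (xhat : ℝ) (hxhat : xhat = 1 - (1 / (K : ℝ)) ^ ((1 : ℝ) / ((K : ℝ) - 1))) :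
    D xhat = (1 / 2) * (1 / (K : ℝ)) ^ ((K : ℝ) / ((K : ℝ) - 1))
        - (1 / 2) * (1 / (K : ℝ)) ^ ((1 : ℝ) / ((K : ℝ) - 1)) + 1 / 2 ∧
    ∀ x ∈ Set.Icc (0:ℝ) 1, D xhat ≤ D x := by
  have hK1 : (0 : ℝ) < K - 1 := by
    have : (2 : ℝ) ≤ K := by exact_mod_cast hK
    linarith
  have hK0 : (0 : ℝ) < K := by linarith
  have hinv : (0 : ℝ) < 1 / K := by positivity
  set t₀ : ℝ := (1 / (K : ℝ)) ^ ((1 : ℝ) / ((K : ℝ) - 1)) with ht₀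
  have hpos : 0 < t₀ := Real.rpow_pos_of_pos hinv _
  have hpow : (1 / (K : ℝ)) ^ ((K : ℝ) / ((K : ℝ) - 1)) = t₀ ^ K := by
    rw [ht₀, ← Real.rpow_mul_natCast hinv.le]
    congr 1
    ring
  have hcrit : K * t₀ ^ K = t₀ := by
    have hexp : (K : ℝ) / (K - 1) = 1 + 1 / (K - 1) := by
      field_simp
      ring
    rw [← hpow, hexp, Real.rpow_add hinv, Real.rpow_one, ← ht₀]
    field_simp
  subst hD hxhat
  refine ⟨?_, fun x hx => ?_⟩
  · rw [hpow]
    ring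
  · have := pow_sub_self_le_of_mul_pow_eq hpos (sub_nonneg.2 hx.2) hcrit
    simp only [sub_sub_cancel]
    linarith
end

section
/- (Lemma 1) Let D_K(x̂_K) = (1/2)(1/K)^{K/(K−1)} − (1/2)(1/K)^{1/(K−1)} + 1/2 for integers K ≥ 2. Then D_K(x̂_K) is asymptotically equivalent to (log K)/(2K), i.e., lim_{K→∞} D_K(x̂_K) / ((log K)/(2K)) = 1. -/
open Filter Real

/-- `log K / (K - 1)` tends to `0` along the natural numbers. -/
theorem tendsto_log_div_sub_one :
    Tendsto (fun K : ℕ => Real.log K / ((K : ℝ) - 1)) atTop (nhds 0) := by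
  have h : Tendsto (fun K : ℕ => 2 * (Real.log K / (K : ℝ))) atTop (nhds 0) := by
    simpa using ((Real.isLittleO_log_id_atTop.tendsto_div_nhds_zero).comp
      tendsto_natCast_atTop_atTop).const_mul (2 : ℝ)
  refine tendsto_of_tendsto_of_tendsto_of_le_of_le' tendsto_const_nhds h ?_ ?_
  all_goals
    filter_upwards [eventually_ge_atTop 2] with K hK
    have hK' : (2 : ℝ) ≤ K := by exact_mod_cast hK
    have hL : 0 ≤ Real.log K := Real.log_nonneg (by linarith)
  · exact div_nonneg hL (by linarith)
  · rw [← mul_div_assoc, div_le_div_iff₀ (by linarith) (by linarith)]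
    nlinarith

/-- `(1 - exp (-t)) / t` tends to `1` as `t` tends to `0`. -/
theorem tendsto_one_sub_exp_neg_div :
    Tendsto (fun t : ℝ => (1 - Real.exp (-t)) / t) (nhdsWithin 0 {0}ᶜ) (nhds 1) := by
  have h : HasDerivAt (fun t : ℝ => 1 - Real.exp (-t)) 1 0 := by
    simpa using ((hasDerivAt_neg (0 : ℝ)).exp).const_sub 1
  refine (hasDerivAt_iff_tendsto_slope.1 h).congr fun t => ?_
  simp [slope_def_field]

/-- Closed form of the normalized minimum metric in terms of `t = log x / (x - 1)`. -/
theorem min_metric_div_eq {x : ℝ} (hx : 1 < x) :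
    ((1 / 2) * (1 / x) ^ (x / (x - 1)) - (1 / 2) * (1 / x) ^ (1 / (x - 1)) + 1 / 2)
        / (Real.log x / (2 * x))
      = (Real.log x)⁻¹
        + (1 - Real.exp (-(Real.log x / (x - 1)))) / (Real.log x / (x - 1)) := by
  have hx0 : 0 < x := by linarith
  have hx1 : x - 1 ≠ 0 := by linarith
  have hL : Real.log x ≠ 0 := (Real.log_pos hx).ne'
  have hexp : x / (x - 1) = 1 + 1 / (x - 1) := by field_simp; ring
  have hpow : (1 / x) ^ (1 / (x - 1)) = Real.exp (-(Real.log x / (x - 1))) := by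
    rw [Real.rpow_def_of_pos (by positivity), one_div x, Real.log_inv]
    congr 1
    ring
  rw [hexp, Real.rpow_add (by positivity), Real.rpow_one, hpow]
  field_simp
  ring

/-- (Lemma 1) `D_K(xhat_K) = (1/2)(1/K)^(K/(K−1)) − (1/2)(1/K)^(1/(K−1)) + 1/2` is
asymptotically equivalent to `(log K)/(2K)`:
`lim_{K→∞} D_K(xhat_K) / ((log K)/(2K)) = 1`. -/
theorem oia_one_bit_min_metric_asymptotics
    (D : ℕ → ℝ)
    (hD : ∀ K : ℕ, D K = (1 / 2) * (1 / (K : ℝ)) ^ ((K : ℝ) / ((K : ℝ) - 1))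
        - (1 / 2) * (1 / (K : ℝ)) ^ ((1 : ℝ) / ((K : ℝ) - 1)) + 1 / 2) :
    Tendsto (fun K : ℕ => D K / (Real.log K / (2 * (K : ℝ)))) atTop (nhds 1) := by
  have ht : Tendsto (fun K : ℕ => Real.log K / ((K : ℝ) - 1)) atTop (nhdsWithin 0 {0}ᶜ) := by
    refine tendsto_nhdsWithin_iff.2 ⟨tendsto_log_div_sub_one, ?_⟩
    filter_upwards [eventually_ge_atTop 2] with K hK
    have hK' : (1 : ℝ) < K := by exact_mod_cast hK
    exact (div_pos (Real.log_pos hK') (by linarith)).ne'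
  have hL : Tendsto (fun K : ℕ => (Real.log K)⁻¹) atTop (nhds 0) :=
    tendsto_inv_atTop_zero.comp (Real.tendsto_log_atTop.comp tendsto_natCast_atTop_atTop)
  have h := hL.add (tendsto_one_sub_exp_neg_div.comp ht)
  rw [zero_add] at h
  refine h.congr' ?_
  filter_upwards [eventually_ge_atTop 2] with K hK
  have hK' : (1 : ℝ) < K := by exact_mod_cast hK
  rw [hD, min_metric_div_eq hK', Function.comp_apply]
end

section
/- (Theorem 1, d = 1) Fix d' ∈ (0, 1]. For P > 1 let K(P) = ⌈P^{d'}⌉ and let D(K) = (1/2)(1/K)^{K/(K−1)} − (1/2)(1/K)^{1/(K−1)} + 1/2 for K ≥ 2. Then lim_{P→∞} log(1 + P · D(K(P))) / log P = 1 − d'. Consequently, the degrees-of-freedom loss of OIA with 1-bit feedback and optimal threshold is at most 1 − d', so DoF d' is achieved when the number of users scales as K ∝ P^{d'}. -/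
open Filter Real

/-- The minimized expected metric of the 1-bit scheme with `K ≥ 2` users lies between
`1 / (2K)` and `(log K + 1) / K`. -/
theorem one_bit_metric_bounds {k : ℝ} (hk : 2 ≤ k) :
    1 / (2 * k) ≤ (1 / 2) * (1 / k) ^ (k / (k - 1)) - (1 / 2) * (1 / k) ^ (1 / (k - 1)) + 1 / 2 ∧
    (1 / 2) * (1 / k) ^ (k / (k - 1)) - (1 / 2) * (1 / k) ^ (1 / (k - 1)) + 1 / 2
      ≤ (Real.log k + 1) / k := by
  have hk0 : 0 < k := by linarith
  have hk1 : 0 < k - 1 := by linarith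
  have hlog : 0 ≤ Real.log k := Real.log_nonneg (by linarith)
  have hsplit : (1 / k) ^ (k / (k - 1)) = (1 / k) * (1 / k) ^ (1 / (k - 1)) := by
    rw [show k / (k - 1) = 1 + 1 / (k - 1) by field_simp; ring,
      Real.rpow_add (by positivity), Real.rpow_one]
  have hy : (1 / k) ^ (1 / (k - 1)) = Real.exp (-(Real.log k / (k - 1))) := by
    rw [Real.rpow_def_of_pos (by positivity), one_div k, Real.log_inv]
    congr 1
    ring
  have ht : Real.log k / (k - 1) ≤ 2 * Real.log k / k := by
    rw [div_le_div_iff₀ hk1 hk0]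
    nlinarith
  have hy0 := Real.add_one_le_exp (-(Real.log k / (k - 1)))
  have hy1 : Real.exp (-(Real.log k / (k - 1))) ≤ 1 :=
    Real.exp_le_one_iff.2 (neg_nonpos.2 (by positivity))
  rw [hsplit, hy]
  set y := Real.exp (-(Real.log k / (k - 1)))
  have hi0 : 0 < 1 / k := by positivity
  have hi1 : 1 / k ≤ 1 := by rw [div_le_one hk0]; linarith
  have e1 : 1 / (2 * k) = 1 / 2 * (1 / k) := by field_simp
  have e2 : (Real.log k + 1) / k = 1 / 2 * (2 * Real.log k / k) + 1 / k := by field_simp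
  constructor
  · rw [e1]
    nlinarith [mul_nonneg (sub_nonneg.2 hy1) (sub_nonneg.2 hi1)]
  · rw [e2]
    nlinarith [mul_nonneg (sub_nonneg.2 hy1) hi0.le]

theorem tendsto_log_const_mul_div_atTop {c : ℝ} (hc : 0 < c) :
    Tendsto (fun x : ℝ => Real.log (c * x) / x) atTop (nhds 0) := by
  have h1 : Tendsto (fun x : ℝ => Real.log c / x) atTop (nhds 0) :=
    tendsto_const_nhds.div_atTop tendsto_id
  have h2 : Tendsto (fun x : ℝ => Real.log x / x) atTop (nhds 0) :=
    Real.isLittleO_log_id_atTop.tendsto_div_nhds_zero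
  have h3 := h1.add h2
  rw [add_zero] at h3
  refine h3.congr' ?_
  filter_upwards [eventually_gt_atTop 0] with x hx
  rw [Real.log_mul hc.ne' hx.ne', add_div]

/-- (Theorem 1, `d = 1`) Fix `d' ∈ (0,1]`. With `K(P) = ⌈P^{d'}⌉` users and the minimized
expected metric `D(K) = (1/2)(1/K)^(K/(K−1)) − (1/2)(1/K)^(1/(K−1)) + 1/2` of the 1-bit
feedback scheme with optimal threshold, the (normalized) rate-loss bound satisfies
`lim_{P→∞} log(1 + P·D(K(P))) / log P = 1 − d'`, so the DoF loss is at most `1 − d'`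
and DoF `d'` is achieved. -/
theorem oia_one_bit_dof_d_eq_one (d' : ℝ) (hd' : d' ∈ Set.Ioc (0:ℝ) 1)
    (D : ℕ → ℝ)
    (hD : ∀ K : ℕ, D K = (1 / 2) * (1 / (K : ℝ)) ^ ((K : ℝ) / ((K : ℝ) - 1))
        - (1 / 2) * (1 / (K : ℝ)) ^ ((1 : ℝ) / ((K : ℝ) - 1)) + 1 / 2)
    (Kf : ℝ → ℕ) (hKf : ∀ P : ℝ, Kf P = ⌈P ^ d'⌉₊) :
    Tendsto (fun P : ℝ => Real.log (1 + P * D (Kf P)) / Real.log P)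
      atTop (nhds (1 - d')) := by
  obtain ⟨hd0, hd1⟩ := hd'
  have hlow : Tendsto (fun P : ℝ => (1 - d') - Real.log 4 / Real.log P) atTop
      (nhds (1 - d')) := by
    simpa using (tendsto_const_nhds (x := 1 - d')).sub
      ((tendsto_const_nhds (x := Real.log 4)).div_atTop Real.tendsto_log_atTop)
  have hup : Tendsto (fun P : ℝ => (1 - d') + Real.log (4 * Real.log P) / Real.log P) atTop
      (nhds (1 - d')) := by
    simpa using (tendsto_const_nhds (x := 1 - d')).add
      ((tendsto_log_const_mul_div_atTop (c := 4) (by norm_num)).comp Real.tendsto_log_atTop)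
  have hbounds : ∀ᶠ P : ℝ in atTop, 1 ≤ Real.log P ∧
      (1 - d') * Real.log P - Real.log 4 ≤ Real.log (1 + P * D (Kf P)) ∧
      Real.log (1 + P * D (Kf P)) ≤ (1 - d') * Real.log P + Real.log (4 * Real.log P) := by
    filter_upwards [Real.tendsto_log_atTop.eventually_ge_atTop 1, eventually_gt_atTop 1]
      with P hL hP
    have hP0 : 0 < P := by linarith
    have hq1 : 1 < P ^ d' := Real.one_lt_rpow hP hd0
    have hK2 : (2 : ℝ) ≤ Kf P := by
      have : 1 < Kf P := by
        rw [hKf, Nat.lt_ceil]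
        exact_mod_cast hq1
      exact_mod_cast this
    have hKlow : P ^ d' ≤ Kf P := by
      rw [hKf]
      exact Nat.le_ceil _
    have hKup : (Kf P : ℝ) ≤ 2 * P ^ d' := by
      have := Nat.ceil_lt_add_one (zero_le_one.trans hq1.le)
      rw [hKf]
      linarith
    have hlogK : Real.log (Kf P) ≤ Real.log P + 1 := by
      have h := Real.log_le_log (by linarith) hKup
      rw [Real.log_mul two_ne_zero (by positivity), Real.log_rpow hP0] at h
      nlinarith [Real.log_two_lt_d9]
    obtain ⟨hD1, hD2⟩ := one_bit_metric_bounds hK2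
    rw [← hD] at hD1 hD2
    have hr : P = P ^ (1 - d') * P ^ d' := by
      rw [← Real.rpow_add hP0, sub_add_cancel, Real.rpow_one]
    have hr1 : 1 ≤ P ^ (1 - d') := Real.one_le_rpow hP.le (by linarith)
    have hPD1 : P ^ (1 - d') / 4 ≤ P * D (Kf P) :=
      calc P ^ (1 - d') / 4 = P * (1 / (2 * (2 * P ^ d'))) := by
            nth_rewrite 2 [hr]
            field_simp
            norm_num
        _ ≤ P * (1 / (2 * Kf P)) := by gcongr
        _ ≤ P * D (Kf P) := by gcongr
    have hPD2 : P * D (Kf P) ≤ P ^ (1 - d') * (Real.log P + 2) :=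
      calc P * D (Kf P) ≤ P * ((Real.log (Kf P) + 1) / Kf P) := by gcongr
        _ ≤ P * ((Real.log P + 2) / P ^ d') := by
            gcongr ?_ * ?_
            exact div_le_div₀ (by linarith) (by linarith) (by linarith) hKlow
        _ = P ^ (1 - d') * (Real.log P + 2) := by
            nth_rewrite 1 [hr]
            field_simp
    refine ⟨hL, ?_, ?_⟩
    · rw [← Real.log_rpow hP0, ← Real.log_div (by positivity) (by norm_num)]
      exact Real.log_le_log (by positivity) (by linarith)
    · rw [← Real.log_rpow hP0, ← Real.log_mul (by positivity) (by positivity)]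
      exact Real.log_le_log (by linarith) (by nlinarith)
  refine tendsto_of_tendsto_of_tendsto_of_le_of_le' hlow hup ?_ ?_
  · filter_upwards [hbounds] with P ⟨hL, h, _⟩
    have : Real.log P ≠ 0 := by linarith
    rw [le_div_iff₀ (by linarith), sub_mul, div_mul_cancel₀ _ this]
    exact h
  · filter_upwards [hbounds] with P ⟨hL, _, h⟩
    have : Real.log P ≠ 0 := by linarith
    rw [div_le_iff₀ (by linarith), add_mul, div_mul_cancel₀ _ this]
    exact h
end

section
/- (Theorem 2, general d) Let d be a positive integer, c > 0 and B real constants, A = 1/d², and fix d' ∈ (0, d]. For P > 1 let K(P) = ⌈P^{d·d'}⌉, ŷ_K = (A log K + B)/K, and D̃_K(y) = (y/c)^{1/d²} + d·e^{−K y}. Then lim_{P→∞} log(1 + (P/d)·D̃_{K(P)}(ŷ_{K(P)})) / log P = 1 − d'/d. Consequently the degrees-of-freedom loss d·lim_{P→∞} log₂(1 + (P/d)·D̃_{K(P)}(ŷ_{K(P)}))/log₂ P equals d − d', so DoF d' per transmitter is achieved with 1-bit feedback when the number of users scales as K ∝ P^{d·d'} and the threshold x̂ satisfies c·x̂^{d²}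 = (A log K + B)/K. -/
open Filter Real

/-- If `log Z / log P → ℓ` with `ℓ ≥ 0`, replacing `Z` by `1 + Z` does not change the limit. -/
theorem tendsto_log_one_add_div_log {Z : ℝ → ℝ} {l : ℝ} (hl : 0 ≤ l)
    (hZ : ∀ᶠ P in atTop, 0 < Z P)
    (h : Tendsto (fun P => Real.log (Z P) / Real.log P) atTop (nhds l)) :
    Tendsto (fun P => Real.log (1 + Z P) / Real.log P) atTop (nhds l) := by
  have hupper : Tendsto (fun P => Real.log 2 / Real.log P + max 0 (Real.log (Z P) / Real.log P))
      atTop (nhds l) := by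
    simpa [hl] using
      (tendsto_const_nhds.div_atTop Real.tendsto_log_atTop).add (tendsto_const_nhds (x := (0 : ℝ)).max h)
  refine tendsto_of_tendsto_of_tendsto_of_le_of_le' h hupper ?_ ?_
  · filter_upwards [hZ, eventually_gt_atTop 1] with P hP hP1
    have := Real.log_pos hP1
    gcongr
    linarith
  · filter_upwards [hZ, eventually_gt_atTop 1] with P hP hP1
    have hlog := Real.log_pos hP1
    rcases le_total (Z P) 1 with h1 | h1
    · calc Real.log (1 + Z P) / Real.log P ≤ Real.log 2 / Real.log P := by
            gcongr; linarith
        _ ≤ _ := le_add_of_nonneg_right (le_max_left _ _)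
    · calc Real.log (1 + Z P) / Real.log P ≤ Real.log (2 * Z P) / Real.log P := by
            gcongr; linarith
        _ = Real.log 2 / Real.log P + Real.log (Z P) / Real.log P := by
            rw [Real.log_mul two_ne_zero hP.ne', add_div]
        _ ≤ _ := by gcongr; exact le_max_right _ _

theorem tendsto_log_natCeil_rpow_div_log {a : ℝ} (ha : 0 < a) :
    Tendsto (fun P : ℝ => Real.log (⌈P ^ a⌉₊ : ℝ) / Real.log P) atTop (nhds a) := by
  have hupper : Tendsto (fun P => Real.log 2 / Real.log P + a) atTop (nhds a) := by
    simpa using (tendsto_const_nhds.div_atTop Real.tendsto_log_atTop).add_const a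
  refine tendsto_of_tendsto_of_tendsto_of_le_of_le' tendsto_const_nhds hupper ?_ ?_
  · filter_upwards [eventually_gt_atTop 1] with P hP
    have hlog := Real.log_pos hP
    have hpos : 0 < P ^ a := Real.rpow_pos_of_pos (by linarith) a
    rw [le_div_iff₀ hlog, ← Real.log_rpow (by linarith)]
    exact Real.log_le_log hpos (Nat.le_ceil _)
  · filter_upwards [eventually_gt_atTop 1] with P hP
    have hlog := Real.log_pos hP
    have hone : 1 ≤ P ^ a := Real.one_le_rpow hP.le ha.le
    have hceil : (⌈P ^ a⌉₊ : ℝ) ≤ 2 * P ^ a := by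
      linarith [Nat.ceil_lt_add_one (zero_le_one.trans hone)]
    have hceil_pos : (0 : ℝ) < ⌈P ^ a⌉₊ := by linarith [Nat.le_ceil (P ^ a)]
    rw [div_add' _ _ _ hlog.ne', ← Real.log_rpow (by linarith),
      ← Real.log_mul two_ne_zero (by linarith)]
    gcongr

theorem tendsto_log_rpow_affine_add_const_div {A α β C : ℝ} (hA1 : A ≤ 1)
    (hα : 0 < α) (hC : 0 < C) :
    Tendsto (fun L : ℝ => Real.log ((α * L + β) ^ A + C) / L) atTop (nhds 0) := by
  have haff : ∀ b : ℝ, Tendsto (fun L : ℝ => α * L + b) atTop atTop := fun b =>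
    tendsto_atTop_add_const_right _ b (tendsto_id.const_mul_atTop hα)
  have hupper : Tendsto (fun L : ℝ => Real.log (α * L + (β + C)) / L) atTop (nhds 0) := by
    have hlittle : Asymptotics.IsLittleO atTop
        (fun L : ℝ => Real.log (α * L + (β + C))) (fun L : ℝ => α * L + (β + C)) :=
      Real.isLittleO_log_id_atTop.comp_tendsto (haff (β + C))
    refine (hlittle.trans_isBigO (k := fun L : ℝ => L) ?_).tendsto_div_nhds_zero
    exact ((Asymptotics.isBigO_refl _ _).const_mul_left α).add
      (Asymptotics.isLittleO_const_id_atTop _).isBigO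
  refine tendsto_of_tendsto_of_tendsto_of_le_of_le'
    (tendsto_const_nhds.div_atTop tendsto_id : Tendsto (fun L : ℝ => Real.log C / L) atTop _)
    hupper ?_ ?_
  · filter_upwards [eventually_gt_atTop 0, (haff β).eventually_ge_atTop 0] with L hL hu
    have := Real.rpow_nonneg hu A
    gcongr
    linarith
  · filter_upwards [eventually_gt_atTop 0, (haff β).eventually_ge_atTop 1] with L hL hu
    have hle : (α * L + β) ^ A ≤ α * L + β := by
      simpa using Real.rpow_le_rpow_of_exponent_le hu hA1
    have := Real.rpow_nonneg (zero_le_one.trans hu) A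
    exact div_le_div_of_nonneg_right
      (Real.log_le_log (by linarith) (by linarith)) hL.le

/-- (Theorem 2, general `d`) Let `d ≥ 1`, `c > 0`, `B ∈ ℝ`, `A = 1/d²`, and fix
`d' ∈ (0, d]`. With `K(P) = ⌈P^{d·d'}⌉` users, threshold parameter
`yhat_K = (A log K + B)/K` and `Dt_K(y) = (y/c)^{1/d²} + d·e^{−K y}`, one has
`lim_{P→∞} log(1 + (P/d)·Dt_{K(P)}(yhat_{K(P)})) / log P = 1 − d'/d`;
consequently the DoF loss `d·lim_{P→∞} log₂(1 + (P/d)·Dt)/log₂ P` equals `d − d'`,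
so DoF `d'` per transmitter is achieved with 1-bit feedback. -/
theorem oia_one_bit_dof_general_d (d : ℕ) (hd : 0 < d)
    (c B A : ℝ) (hc : 0 < c) (hA : A = 1 / (d : ℝ) ^ 2)
    (d' : ℝ) (hd' : d' ∈ Set.Ioc (0:ℝ) (d : ℝ))
    (Kf : ℝ → ℕ) (hKf : ∀ P : ℝ, Kf P = ⌈P ^ ((d : ℝ) * d')⌉₊)
    (yhat : ℕ → ℝ) (hyhat : ∀ K : ℕ, yhat K = (A * Real.log K + B) / (K : ℝ))
    (Dt : ℕ → ℝ → ℝ)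
    (hDt : ∀ (K : ℕ) (y : ℝ), Dt K y
        = (y / c) ^ ((1 : ℝ) / (d : ℝ) ^ 2) + (d : ℝ) * Real.exp (-(K : ℝ) * y)) :
    Tendsto
      (fun P : ℝ => Real.log (1 + (P / d) * Dt (Kf P) (yhat (Kf P))) / Real.log P)
      atTop (nhds (1 - d' / d)) ∧
    Tendsto
      (fun P : ℝ =>
        (d : ℝ) * (Real.logb 2 (1 + (P / d) * Dt (Kf P) (yhat (Kf P))) / Real.logb 2 P))
      atTop (nhds ((d : ℝ) - d')) := by
  have hd0 : (0 : ℝ) < d := by exact_mod_cast hd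
  have hd1 : (1 : ℝ) ≤ d := by exact_mod_cast hd
  have hA0 : 0 < A := by rw [hA]; positivity
  have hA1 : A ≤ 1 := by
    rw [hA, div_le_one (by positivity)]
    exact one_le_pow₀ hd1
  obtain ⟨hd'0, hd'd⟩ := hd'
  have ha : 0 < (d : ℝ) * d' := mul_pos hd0 hd'0
  have hl : 0 ≤ 1 - d' / d := sub_nonneg.2 ((div_le_one hd0).2 hd'd)
  have hratio : Tendsto (fun P => Real.log (Kf P) / Real.log P) atTop (nhds (d * d')) := by
    simpa only [hKf] using tendsto_log_natCeil_rpow_div_log ha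
  have hKtop : Tendsto (fun P => (Kf P : ℝ)) atTop atTop := by
    simp only [hKf]
    exact tendsto_atTop_mono (fun P => Nat.le_ceil _) (tendsto_rpow_atTop ha)
  have hLtop : Tendsto (fun P => Real.log (Kf P)) atTop atTop :=
    Real.tendsto_log_atTop.comp hKtop
  let G : ℝ → ℝ := fun L => (A / c * L + B / c) ^ A + d * Real.exp (-B)
  have hG : Tendsto (fun P => Real.log (G (Real.log (Kf P))) / Real.log P) atTop (nhds 0) := by
    have hlim := ((tendsto_log_rpow_affine_add_const_div (β := B / c) hA1
      (div_pos hA0 hc) (mul_pos hd0 (Real.exp_pos (-B)))).comp hLtop).mul hratio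
    rw [zero_mul] at hlim
    refine hlim.congr' ?_
    filter_upwards [hLtop.eventually_gt_atTop 0] with P hL
    exact div_mul_div_cancel₀ hL.ne'
  have haff : ∀ᶠ P in atTop, 0 ≤ A / c * Real.log (Kf P) + B / c :=
    (tendsto_atTop_add_const_right _ (B / c)
      (hLtop.const_mul_atTop (div_pos hA0 hc))).eventually_ge_atTop 0
  have hGpos : ∀ᶠ P in atTop, 0 < G (Real.log (Kf P)) := by
    filter_upwards [haff] with P hP
    have := Real.rpow_nonneg hP A
    positivity
  have hfactor : ∀ᶠ P in atTop, P / d * Dt (Kf P) (yhat (Kf P))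
      = P / d * ((Kf P : ℝ) ^ (-A) * G (Real.log (Kf P))) := by
    filter_upwards [haff, hKtop.eventually_gt_atTop 0] with P hP hK
    rw [hDt, hyhat, ← hA]
    congr 1
    have hbase : (A * Real.log (Kf P) + B) / Kf P / c
        = (Kf P : ℝ)⁻¹ * (A / c * Real.log (Kf P) + B / c) := by
      field_simp
    have hexp : -(Kf P : ℝ) * ((A * Real.log (Kf P) + B) / Kf P)
        = Real.log (Kf P) * (-A) + -B := by
      field_simp
      ring
    rw [hbase, Real.mul_rpow (inv_nonneg.2 hK.le) hP, Real.inv_rpow hK.le, ← Real.rpow_neg hK.le,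
      hexp, Real.exp_add, ← Real.rpow_def_of_pos hK]
    ring
  have hZpos : ∀ᶠ P in atTop, 0 < P / d * Dt (Kf P) (yhat (Kf P)) := by
    filter_upwards [hfactor, hGpos, hKtop.eventually_gt_atTop 0, eventually_gt_atTop 0]
      with P hP hGP hK hP0
    rw [hP]
    positivity
  have hlogZ : Tendsto (fun P => Real.log (P / d * Dt (Kf P) (yhat (Kf P))) / Real.log P)
      atTop (nhds (1 - d' / d)) := by
    have hlim := (((tendsto_const_nhds (x := (1 : ℝ))).sub
      ((tendsto_const_nhds (x := Real.log d)).div_atTop Real.tendsto_log_atTop)).sub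
      (hratio.const_mul A)).add hG
    have hval : 1 - 0 - A * (d * d') + 0 = 1 - d' / d := by
      rw [hA]
      field_simp
      ring
    rw [hval] at hlim
    refine hlim.congr' ?_
    filter_upwards [hfactor, hGpos, hKtop.eventually_gt_atTop 0, eventually_gt_atTop 1]
      with P hP hGP hK hP1
    have hP0 : 0 < P := zero_lt_one.trans hP1
    have hlog := (Real.log_pos hP1).ne'
    rw [hP, Real.log_mul (by positivity) (by positivity), Real.log_div hP0.ne' hd0.ne',
      Real.log_mul (by positivity) hGP.ne', Real.log_rpow hK]
    field_simp
    ring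
  have hmain := tendsto_log_one_add_div_log hl hZpos hlogZ
  refine ⟨hmain, ?_⟩
  have hscaled := hmain.const_mul (d : ℝ)
  rw [mul_sub, mul_one, mul_div_cancel₀ _ hd0.ne'] at hscaled
  simpa only [Real.logb, div_div_div_cancel_right₀ (Real.log_pos one_lt_two).ne'] using hscaled
end
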